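/- Let 𝒫 be a real symmetric positive definite n_z×n_z matrix, c ∈ ℝ^{n_z}, 𝒜, ℬ, 𝒞 real matrices of compatible sizes, and D ⊆ ℝ^{n_d}, V ⊆ ℝ^{n_v} arbitrary sets. Suppose that for every d ∈ D, v ∈ V, and every z ∈ ℝ^{n_z} with (z−c)ᵀ𝒫(z−c) ≥ 1, one has (𝒜z + ℬd + 𝒞v − c)ᵀ𝒫(𝒜z + ℬd + 𝒞v − c) ≤ (z−c)ᵀ𝒫(z−c). Then for every z with (z−c)ᵀ𝒫(z−c) ≤ 1 and every d ∈ D, v ∈ V, one has (𝒜z + ℬd + 𝒞v − c)ᵀ𝒫(𝒜z + ℬd + 𝒞v − c) ≤ 1; in particular the ellipsoid {z : (z−c)ᵀ𝒫(z−c) ≤ 1} is invariant in one step under the map z ↦ 𝒜z + ℬd + 𝒞v for all d ∈ D, v ∈ V. -/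

import Mathlib

open Matrix

theorem Matrix.PosSemidef.dotProduct_mulVec_convex {ι : Type*} [Fintype ι]
    {P : Matrix ι ι ℝ} (hP : P.PosSemidef) (x y : ι → ℝ) {a b : ℝ}
    (ha : 0 ≤ a) (hb : 0 ≤ b) (hab : a + b = 1) :
    (a • x + b • y) ⬝ᵥ (P *ᵥ (a • x + b • y))
      ≤ a * (x ⬝ᵥ (P *ᵥ x)) + b * (y ⬝ᵥ (P *ᵥ y)) := by
  have h : 0 ≤ (x - y) ⬝ᵥ (P *ᵥ (x - y)) := by
    simpa using hP.dotProduct_mulVec_nonneg (x - y)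
  have h' := mul_nonneg (mul_nonneg ha hb) h
  obtain rfl : b = 1 - a := by linarith
  simp only [mulVec_add, mulVec_sub, mulVec_smul, dotProduct_add, dotProduct_sub,
    add_dotProduct, sub_dotProduct, smul_dotProduct, dotProduct_smul, smul_eq_mul] at h' ⊢
  linarith

theorem Matrix.PosDef.exists_smul_dotProduct_mulVec_eq_one {ι : Type*} [Fintype ι]
    {P : Matrix ι ι ℝ} (hP : P.PosDef) {w : ι → ℝ} (hw : w ≠ 0) :
    ∃ u : ι → ℝ, u ⬝ᵥ (P *ᵥ u) = 1 ∧ w = √(w ⬝ᵥ (P *ᵥ w)) • u := by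
  have hpos : 0 < w ⬝ᵥ (P *ᵥ w) := by simpa using hP.dotProduct_mulVec_pos hw
  have hs := (Real.sqrt_pos.2 hpos).ne'
  refine ⟨(√(w ⬝ᵥ (P *ᵥ w)))⁻¹ • w, ?_, (smul_inv_smul₀ hs w).symm⟩
  simp only [mulVec_smul, smul_dotProduct, dotProduct_smul, smul_eq_mul]
  nth_rw 3 [← Real.mul_self_sqrt hpos.le]
  field_simp

/-- Every point of the ellipsoid of a positive definite matrix lies on a diameter. -/
theorem Matrix.PosDef.exists_eq_smul_of_dotProduct_mulVec_le_one {ι : Type*} [Fintype ι]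
    [Nonempty ι] {P : Matrix ι ι ℝ} (hP : P.PosDef) {w : ι → ℝ}
    (hw : w ⬝ᵥ (P *ᵥ w) ≤ 1) :
    ∃ (u : ι → ℝ) (r : ℝ), u ⬝ᵥ (P *ᵥ u) = 1 ∧ 0 ≤ r ∧ r ≤ 1 ∧ w = r • u := by
  by_cases h0 : w = 0
  · obtain ⟨y, hy⟩ := exists_ne (0 : ι → ℝ)
    obtain ⟨u, hu, -⟩ := hP.exists_smul_dotProduct_mulVec_eq_one hy
    exact ⟨u, 0, hu, le_rfl, zero_le_one, by simp [h0]⟩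
  · obtain ⟨u, hu, hwu⟩ := hP.exists_smul_dotProduct_mulVec_eq_one h0
    exact ⟨u, _, hu, Real.sqrt_nonneg _, Real.sqrt_le_one.2 hw, hwu⟩

/-- if the one-step quadratic decrease holds outside the
ellipsoid `{z : (z−c)ᵀ𝒫(z−c) ≤ 1}` for all disturbances `d ∈ D`, `v ∈ V`,
then the ellipsoid is invariant in one step under
`z ↦ 𝒜z + ℬd + 𝒞v` for all `d ∈ D`, `v ∈ V`. -/
theorem one_step_invariance_of_quadratic_decrease {nz nd nv : ℕ}
    (𝒜 : Matrix (Fin nz) (Fin nz) ℝ) (ℬ : Matrix (Fin nz) (Fin nd) ℝ)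
    (𝒞 : Matrix (Fin nz) (Fin nv) ℝ) (P : Matrix (Fin nz) (Fin nz) ℝ)
    (hP : P.PosDef) (c : Fin nz → ℝ)
    (D : Set (Fin nd → ℝ)) (V : Set (Fin nv → ℝ))
    (hdec : ∀ d ∈ D, ∀ v ∈ V, ∀ z : Fin nz → ℝ,
      1 ≤ (z - c) ⬝ᵥ (P *ᵥ (z - c)) →
      (𝒜 *ᵥ z + ℬ *ᵥ d + 𝒞 *ᵥ v - c) ⬝ᵥ (P *ᵥ (𝒜 *ᵥ z + ℬ *ᵥ d + 𝒞 *ᵥ v - c))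
        ≤ (z - c) ⬝ᵥ (P *ᵥ (z - c))) :
    ∀ z : Fin nz → ℝ, (z - c) ⬝ᵥ (P *ᵥ (z - c)) ≤ 1 →
      ∀ d ∈ D, ∀ v ∈ V,
      (𝒜 *ᵥ z + ℬ *ᵥ d + 𝒞 *ᵥ v - c) ⬝ᵥ (P *ᵥ (𝒜 *ᵥ z + ℬ *ᵥ d + 𝒞 *ᵥ v - c))
        ≤ 1 := by
  intro z hz d hd v hv
  cases isEmpty_or_nonempty (Fin nz) with
  | inl h => simp [dotProduct]
  | inr h =>
    obtain ⟨u, r, hu, hr0, hr1, hzu⟩ := hP.exists_eq_smul_of_dotProduct_mulVec_le_one hz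
    have hplus := hdec d hd v hv (c + u) (by simp [hu])
    have hminus := hdec d hd v hv (c - u) (by simp [mulVec_neg, hu])
    simp only [add_sub_cancel_left, sub_sub_cancel_left, mulVec_neg, dotProduct_neg,
      neg_dotProduct, neg_neg, hu] at hplus hminus
    have hcomb : 𝒜 *ᵥ z + ℬ *ᵥ d + 𝒞 *ᵥ v - c
        = ((1 + r) / 2) • (𝒜 *ᵥ (c + u) + ℬ *ᵥ d + 𝒞 *ᵥ v - c)
          + ((1 - r) / 2) • (𝒜 *ᵥ (c - u) + ℬ *ᵥ d + 𝒞 *ᵥ v - c) := by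
      rw [sub_eq_iff_eq_add.1 hzu, mulVec_add, mulVec_add, mulVec_sub, mulVec_smul]
      module
    have ha : 0 ≤ (1 + r) / 2 := by linarith
    have hb : 0 ≤ (1 - r) / 2 := by linarith
    have hconv := hP.posSemidef.dotProduct_mulVec_convex
      (𝒜 *ᵥ (c + u) + ℬ *ᵥ d + 𝒞 *ᵥ v - c) (𝒜 *ᵥ (c - u) + ℬ *ᵥ d + 𝒞 *ᵥ v - c)
      ha hb (by ring)
    rw [← hcomb] at hconv
    linarith [mul_le_mul_of_nonneg_left hplus ha, mul_le_mul_of_nonneg_left hminus hb]
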